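/- Let X ⊂ P^r be an integral non-degenerate variety of dimension n with k < r - n. Then a general element π of G_k(X) satisfies: π ∩ X consists of exactly k+1 points. -/

import Mathlib

open Submodule

noncomputable section

/-- Polynomial functions on a complex module: the subalgebra of functions generated by
the linear functionals. -/
def PolyFun (W : Type*) [AddCommGroup W] [Module ℂ W] : Subalgebra ℂ (W → ℂ) :=
  Algebra.adjoin ℂ {f : W → ℂ | IsLinearMap ℂ f}

/-- A subset of a complex module is algebraic (Zariski closed) if it is the common zero
set of a family of polynomial functions. -/
def IsAlgSet {W : Type*} [AddCommGroup W] [Module ℂ W] (X : Set W) : Prop :=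
  ∃ S : Set (W → ℂ), S ⊆ (PolyFun W : Set (W → ℂ)) ∧ X = {x | ∀ f ∈ S, f x = 0}

/-- Zariski closure. -/
def zcl {W : Type*} [AddCommGroup W] [Module ℂ W] (A : Set W) : Set W :=
  ⋂₀ {Y | IsAlgSet Y ∧ A ⊆ Y}

/-- Irreducible algebraic set. -/
def IsIrrAlg {W : Type*} [AddCommGroup W] [Module ℂ W] (X : Set W) : Prop :=
  X.Nonempty ∧ IsAlgSet X ∧
    ∀ Y Z : Set W, IsAlgSet Y → IsAlgSet Z → X ⊆ Y ∪ Z → X ⊆ Y ∨ X ⊆ Z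

/-- Dimension of an (affine) algebraic set: the supremum of the lengths of strict chains
of irreducible algebraic subsets contained in it. -/
def adim {W : Type*} [AddCommGroup W] [Module ℂ W] (X : Set W) : ℕ∞ :=
  sSup {d : ℕ∞ | ∃ n : ℕ, d = (n : ℕ∞) ∧
    ∃ c : Fin (n + 1) → Set W, StrictMono c ∧ ∀ i, IsIrrAlg (c i) ∧ c i ⊆ X}

/-- Projective dimension of a cone: one less than the dimension of the affine cone. -/
def pdim {W : Type*} [AddCommGroup W] [Module ℂ W] (X : Set W) : ℕ∞ := adim X - 1

/-- A cone in a complex module (the affine cone of a projective set). -/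
def IsCone {W : Type*} [AddCommGroup W] [Module ℂ W] (X : Set W) : Prop :=
  (0 : W) ∈ X ∧ ∀ (c : ℂ) (x : W), x ∈ X → c • x ∈ X

/-- The affine cone of an integral projective variety: an irreducible algebraic cone,
different from the origin alone. -/
def IsProjVar {W : Type*} [AddCommGroup W] [Module ℂ W] (X : Set W) : Prop :=
  IsAlgSet X ∧ IsCone X ∧ IsIrrAlg X ∧ X ≠ {0}

/-- Non-degenerate: the cone spans the ambient space. -/
def Nondeg {W : Type*} [AddCommGroup W] [Module ℂ W] (X : Set W) : Prop :=
  Submodule.span ℂ X = ⊤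

/-- The projective set is a cone over some vertex: there is a point `v` (vertex) of the
variety such that the variety is a union of lines through the vertex. -/
def IsConeVar {W : Type*} [AddCommGroup W] [Module ℂ W] (X : Set W) : Prop :=
  ∃ v ∈ X, v ≠ 0 ∧ ∀ x ∈ X, ∀ a b : ℂ, a • v + b • x ∈ X

/-- Affine cone of the `k`-th secant variety `S_k(X)`: the Zariski closure of the union
of the linear spans of `k+1` points of `X`. -/
def Sec {W : Type*} [AddCommGroup W] [Module ℂ W] (X : Set W) (k : ℕ) : Set W :=
  zcl (⋃ p ∈ {p : Fin (k + 1) → W | ∀ i, p i ∈ X},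
    (Submodule.span ℂ (Set.range p) : Set W))

/-- Plücker points of the spans of `(k+1)`-tuples of points of `X`: the raw affine cone
over the image of the span map `Φ : X^{k+1} ⇢ G(k,r)` in Plücker coordinates. -/
def GkConePre {W : Type*} [AddCommGroup W] [Module ℂ W] (X : Set W) (k : ℕ) :
    Set (ExteriorAlgebra ℂ W) :=
  {w | ∃ p : Fin (k + 1) → W, (∀ i, p i ∈ X) ∧ w = ExteriorAlgebra.ιMulti ℂ (k + 1) p}

/-- Affine cone over `G_k(X)` (in Plücker coordinates): Zariski closure of the cone over
the image of the span map. -/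
def GkCone {W : Type*} [AddCommGroup W] [Module ℂ W] (X : Set W) (k : ℕ) :
    Set (ExteriorAlgebra ℂ W) :=
  zcl (GkConePre X k)

/-- `G_k(X)` as a set of `(k+1)`-dimensional subspaces (projective `k`-planes): those
whose Plücker point lies in the closure of the image of the span map. -/
def Gk {W : Type*} [AddCommGroup W] [Module ℂ W] (X : Set W) (k : ℕ) :
    Set (Submodule ℂ W) :=
  {U | Module.finrank ℂ U = k + 1 ∧
    ∀ p : Fin (k + 1) → W, (∀ i, p i ∈ U) →
      ExteriorAlgebra.ιMulti ℂ (k + 1) p ∈ GkCone X k}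

/-- Raw cone of Plücker points of `h`-planes contained in some `(k+1)`-secant `k`-plane. -/
def GhkConePre {W : Type*} [AddCommGroup W] [Module ℂ W] (X : Set W) (h k : ℕ) :
    Set (ExteriorAlgebra ℂ W) :=
  {w | ∃ (p : Fin (k + 1) → W) (q : Fin (h + 1) → W), (∀ i, p i ∈ X) ∧
    (∀ j, q j ∈ Submodule.span ℂ (Set.range p)) ∧
    w = ExteriorAlgebra.ιMulti ℂ (h + 1) q}

/-- Affine cone over `G_{h,k}(X)` in Plücker coordinates. -/
def GhkCone {W : Type*} [AddCommGroup W] [Module ℂ W] (X : Set W) (h k : ℕ) :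
    Set (ExteriorAlgebra ℂ W) :=
  zcl (GhkConePre X h k)

universe u v

open TensorProduct in
open scoped IntermediateField.algebraAdjoinAdjoin in
theorem IsTranscendenceBasis.exists_derivation {F L ι : Type*} [Field F] [Field L] [Algebra F L]
    [CharZero F] {y : ι → L} (hy : IsTranscendenceBasis F y) (v : ι → L) :
    ∃ D : Derivation F L L, ∀ i, D (y i) = v i := by
  let A := Algebra.adjoin F (Set.range y)
  let K := IntermediateField.adjoin F (Set.range y)
  have : Algebra.FormallyEtale A K := .of_isLocalization (nonZeroDivisors _)
  have : Algebra.IsAlgebraic K L := hy.isAlgebraic_field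
  have : Algebra.FormallyEtale K L := .of_isSeparable _ _
  have : Algebra.FormallyEtale A L := .comp A K L
  let alg : Algebra (MvPolynomial ι F) L := (MvPolynomial.aeval y).toAlgebra
  let alg' : Algebra (MvPolynomial ι F) A := (hy.1.aevalEquiv : MvPolynomial ι F →ₐ[F] A).toAlgebra
  have : IsScalarTower (MvPolynomial ι F) A L := .of_algebraMap_eq fun x => by
    exact (hy.1.algebraMap_aevalEquiv x).symm
  have : IsScalarTower F (MvPolynomial ι F) L := .of_algebraMap_eq fun x => by
    exact (AlgHom.commutes (MvPolynomial.aeval y) x).symm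
  have : Algebra.FormallyEtale (MvPolynomial ι F) A := by
    let e : MvPolynomial ι F ≃ₐ[MvPolynomial ι F] A :=
      { hy.1.aevalEquiv with commutes' := fun _ => rfl }
    exact .of_equiv e
  have : Algebra.FormallyEtale (MvPolynomial ι F) L := .comp _ A L
  let d₀ : Derivation F (MvPolynomial ι F) L := MvPolynomial.mkDerivation F v
  let φ : Ω[L⁄F] →ₗ[L] L :=
    (KaehlerDifferential.isBaseChange_of_formallyEtale F (MvPolynomial ι F) L).lift
      d₀.liftKaehlerDifferential
  refine ⟨φ.compDer (KaehlerDifferential.D F L), fun i => ?_⟩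
  have h1 : y i = algebraMap (MvPolynomial ι F) L (MvPolynomial.X i) :=
    (MvPolynomial.aeval_X y i).symm
  have h2 : KaehlerDifferential.D F L (y i) = KaehlerDifferential.map F F (MvPolynomial ι F) L
      (KaehlerDifferential.D F _ (MvPolynomial.X i)) := by
    rw [KaehlerDifferential.map_D, h1]
  change φ (KaehlerDifferential.D F L (y i)) = v i
  rw [h2]
  erw [IsBaseChange.lift_eq]
  rw [Derivation.liftKaehlerDifferential_comp_D]
  exact MvPolynomial.mkDerivation_X _ _ _
theorem AlgebraicIndependent.exists_derivation {F L ι : Type*} [Field F] [Field L] [Algebra F L]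
    [CharZero F] {x : ι → L} (hx : AlgebraicIndependent F x) (v : ι → L) :
    ∃ D : Derivation F L L, ∀ i, D (x i) = v i := by
  classical
  obtain ⟨s, hs, hb⟩ := exists_isTranscendenceBasis_superset (R := F) hx.coe_range
  obtain ⟨D, hD⟩ := hb.exists_derivation (Function.extend x v 0 ∘ Subtype.val)
  refine ⟨D, fun i => ?_⟩
  have := hD ⟨x i, hs ⟨i, rfl⟩⟩
  simpa [hx.injective.extend_apply] using this
theorem isAlgebraic_of_forall_derivation_eq_zero {F L : Type*} [Field F] [Field L] [Algebra F L]
    [CharZero F] {x : L} (h : ∀ D : Derivation F L L, D x = 0) : IsAlgebraic F x := by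
  by_contra hx
  have : AlgebraicIndependent F (fun _ : Unit => x) := by
    rw [algebraicIndependent_unique_type_iff]
    exact hx
  obtain ⟨D, hD⟩ := this.exists_derivation 1
  simpa [h D] using hD ()

/-- The coordinates indexed by `J` are algebraically independent as functions on `X`. -/
def CoordIndepOn {κ : Type*} (X : Set (κ → ℂ)) (J : Set κ) : Prop :=
  ∀ f : MvPolynomial J ℂ, (∀ x ∈ X, MvPolynomial.eval (fun j : J => x j) f = 0) → f = 0

/-- `ξ` is a generic tuple of points `X`. -/
def IsGenericTuple {ι κ L : Type*} [Field L] [Algebra ℂ L] (X : Set (κ → ℂ))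
    (ξ : ι → κ → L) : Prop :=
  ∀ g : MvPolynomial (ι × κ) ℂ, MvPolynomial.aeval (fun x => ξ x.1 x.2) g = 0 ↔
    ∀ p : ι → κ → ℂ, (∀ i, p i ∈ X) → MvPolynomial.eval (fun x => p x.1 x.2) g = 0

/-- The field generated by the coordinates of all the points `ξ i'` with `i' ≠ i`. -/
def othersField {ι κ L : Type*} [Field L] [Algebra ℂ L] (ξ : ι → κ → L) (i : ι) :
    IntermediateField ℂ L :=
  IntermediateField.adjoin ℂ (Set.range fun x : {x : ι × κ // x.1 ≠ i} => ξ x.1.1 x.1.2)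

theorem mem_othersField {ι κ L : Type*} [Field L] [Algebra ℂ L] (ξ : ι → κ → L) {i i' : ι}
    (h : i' ≠ i) (j : κ) : ξ i' j ∈ othersField ξ i :=
  IntermediateField.subset_adjoin _ _ ⟨⟨(i', j), h⟩, rfl⟩

theorem exists_common_denominator {σ τ k L : Type*} [Finite τ] [Field k] [Field L] [Algebra k L]
    (y : σ → L) (c : τ → L) (hc : ∀ t, c t ∈ IntermediateField.adjoin k (Set.range y)) :
    ∃ (d : L) (C : τ → MvPolynomial σ k), d ≠ 0 ∧ ∀ t, d * c t = MvPolynomial.aeval y (C t) := by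
  classical
  cases nonempty_fintype τ
  have h : ∀ t, ∃ a b : MvPolynomial σ k, MvPolynomial.aeval y b ≠ 0 ∧
      MvPolynomial.aeval y b * c t = MvPolynomial.aeval y a := by
    intro t
    obtain ⟨a, b, hab⟩ := (IntermediateField.mem_adjoin_range_iff _ _ _).1 (hc t)
    by_cases hb : MvPolynomial.aeval y b = 0
    · exact ⟨0, 1, by simp, by simp [hab, hb]⟩
    · exact ⟨a, b, hb, by rw [hab]; field_simp⟩
  choose a b hb hab using h
  refine ⟨∏ t, MvPolynomial.aeval y (b t), fun t => (∏ s ∈ Finset.univ.erase t, b s) * a t,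
    Finset.prod_ne_zero_iff.2 fun t _ => hb t, fun t => ?_⟩
  rw [map_mul, ← hab, map_prod, ← mul_assoc, Finset.prod_erase_mul _ _ (Finset.mem_univ t)]

section Generic

variable {ι κ L : Type*} [Field L] [Algebra ℂ L] {X : Set (κ → ℂ)} {ξ : ι → κ → L}

/-- The specialization at a tuple of points of a polynomial in the coordinates
of the points other than `i`. -/
def evalOthers (p : ι → κ → ℂ) (i : ι) :
    MvPolynomial {x : ι × κ // x.1 ≠ i} ℂ →+* ℂ :=
  MvPolynomial.eval fun x => p x.1.1 x.1.2

theorem evalOthers_update [DecidableEq ι] (p : ι → κ → ℂ) (i : ι) (x : κ → ℂ) :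
    evalOthers (Function.update p i x) i = evalOthers p i := by
  unfold evalOthers
  congr 1
  ext x
  simp [Function.update_of_ne x.2]

theorem IsGenericTuple.sum_eq_zero_iff (hξ : IsGenericTuple X ξ) {τ : Type*} [Fintype τ] (i : ι)
    (C : τ → MvPolynomial {x : ι × κ // x.1 ≠ i} ℂ) (f : τ → MvPolynomial κ ℂ) :
    ∑ t, MvPolynomial.aeval (fun x : {x : ι × κ // x.1 ≠ i} => ξ x.1.1 x.1.2) (C t) *
      MvPolynomial.aeval (ξ i) (f t) = 0 ↔
    ∀ p : ι → κ → ℂ, (∀ i, p i ∈ X) → ∀ x ∈ X,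
      ∑ t, evalOthers p i (C t) * MvPolynomial.eval x (f t) = 0 := by
  classical
  have h := hξ (∑ t, MvPolynomial.rename Subtype.val (C t) *
    MvPolynomial.rename (fun j => (i, j)) (f t))
  simp only [map_sum, map_mul, MvPolynomial.aeval_rename, MvPolynomial.eval_rename] at h
  refine Iff.trans h ⟨fun h p hp x hx => ?_, fun h p hp => h p hp _ (hp i)⟩
  have := h (Function.update p i x) fun i' => by
    by_cases hi : i' = i
    · subst hi; simpa
    · simpa [hi] using hp i'
  rw [← evalOthers_update p i x]
  refine Eq.trans (Finset.sum_congr rfl fun t _ => ?_) this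
  simp only [evalOthers, Function.comp_def, Function.update_self]

theorem IsGenericTuple.aeval_others_eq_zero_iff (hξ : IsGenericTuple X ξ) (hX : X.Nonempty) (i : ι)
    (C : MvPolynomial {x : ι × κ // x.1 ≠ i} ℂ) :
    MvPolynomial.aeval (fun x : {x : ι × κ // x.1 ≠ i} => ξ x.1.1 x.1.2) C = 0 ↔
    ∀ p : ι → κ → ℂ, (∀ i, p i ∈ X) → evalOthers p i C = 0 := by
  obtain ⟨x, hx⟩ := hX
  have := hξ.sum_eq_zero_iff (τ := Unit) i (fun _ => C) (fun _ => 1)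
  simp only [Finset.univ_unique, Finset.sum_singleton, map_one, mul_one] at this
  exact this.trans ⟨fun h p hp => h p hp x hx, fun h p hp _ _ => h p hp⟩

theorem IsGenericTuple.aeval_eq_zero_iff (hξ : IsGenericTuple X ξ) [Nonempty ι] (i : ι)
    (f : MvPolynomial κ ℂ) :
    MvPolynomial.aeval (ξ i) f = 0 ↔ ∀ x ∈ X, MvPolynomial.eval x f = 0 := by
  have := hξ.sum_eq_zero_iff (τ := Unit) i (fun _ => 1) (fun _ => f)
  simp only [Finset.univ_unique, Finset.sum_singleton, map_one, one_mul] at this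
  exact this.trans ⟨fun h x hx => h (fun _ => x) (fun _ => hx) x hx, fun h p hp => h⟩

theorem IsGenericTuple.eq_zero_of_sum_eq_zero (hξ : IsGenericTuple X ξ) (hX : X.Nonempty)
    {τ : Type*} [Fintype τ] (f : τ → MvPolynomial κ ℂ)
    (hf : ∀ c : τ → ℂ, (∀ x ∈ X, ∑ t, c t * MvPolynomial.eval x (f t) = 0) → c = 0)
    {i : ι} {c : τ → L} (hc : ∀ t, c t ∈ othersField ξ i)
    (h : ∑ t, c t * MvPolynomial.aeval (ξ i) (f t) = 0) : c = 0 := by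
  obtain ⟨d, C, hd, hC⟩ := exists_common_denominator _ c hc
  have h' : ∑ t, d * c t * MvPolynomial.aeval (ξ i) (f t) = 0 := by
    simp_rw [mul_assoc]
    rw [← Finset.mul_sum, h, mul_zero]
  simp_rw [hC] at h'
  rw [hξ.sum_eq_zero_iff] at h'
  funext t
  refine (mul_eq_zero.1 ?_).resolve_left hd
  rw [hC, hξ.aeval_others_eq_zero_iff hX]
  exact fun p hp => congr_fun (hf _ (h' p hp)) t

theorem IsGenericTuple.linear_eq_zero [Fintype κ] (hξ : IsGenericTuple X ξ) (hX : X.Nonempty)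
    (hnd : ∀ c : κ → ℂ, (∀ x ∈ X, ∑ j, c j * x j = 0) → c = 0)
    {i : ι} {c : κ → L} (hc : ∀ t, c t ∈ othersField ξ i) (h : ∑ j, c j * ξ i j = 0) : c = 0 :=
  hξ.eq_zero_of_sum_eq_zero hX MvPolynomial.X (by simpa using hnd) hc (by simpa using h)

theorem IsGenericTuple.algebraicIndependent (hξ : IsGenericTuple X ξ) (hX : X.Nonempty)
    {J : Set κ} (hJ : CoordIndepOn X J) (i : ι) :
    AlgebraicIndependent (othersField ξ i) (fun j : J => ξ i j) := by
  classical
  rw [algebraicIndependent_iff]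
  intro p hp
  have key := hξ.eq_zero_of_sum_eq_zero hX (τ := p.support) (i := i)
    (fun t => MvPolynomial.rename Subtype.val (MvPolynomial.monomial t.1 (1 : ℂ)))
    (fun c hc => ?_) (c := fun t => algebraMap (othersField ξ i) L (p.coeff t.1))
    (fun t => (p.coeff t.1).2) ?_
  · ext m
    by_cases hm : m ∈ p.support
    · exact congr_arg Subtype.val ((algebraMap (othersField ξ i) L).injective
        ((congr_fun key ⟨m, hm⟩).trans (map_zero _).symm))
    · simpa using hm
  · have : ∑ t : p.support, MvPolynomial.monomial t.1 (c t) = 0 := hJ _ fun x hx => by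
      rw [map_sum, ← hc x hx]
      refine Finset.sum_congr rfl fun t _ => ?_
      rw [MvPolynomial.eval_rename]
      simp [MvPolynomial.eval_monomial]
    funext t
    have h2 := congr_arg (MvPolynomial.coeff t.1) this
    rw [MvPolynomial.coeff_sum] at h2
    simp only [MvPolynomial.coeff_monomial, MvPolynomial.coeff_zero, Subtype.val_inj,
      Finset.sum_ite_eq', Finset.mem_univ, if_true] at h2
    exact h2
  · conv_lhs at hp => rw [MvPolynomial.aeval_def, MvPolynomial.eval₂_eq]
    rw [← hp]
    refine (Eq.trans ?_ (Finset.sum_coe_sort p.support _))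
    refine Finset.sum_congr rfl fun t _ => ?_
    rw [MvPolynomial.aeval_rename, MvPolynomial.aeval_monomial]
    simp [Finsupp.prod]

theorem IsGenericTuple.coordIndepOn_iff (hξ : IsGenericTuple X ξ) {J : Set κ} (i : ι) :
    CoordIndepOn X J ↔ AlgebraicIndepOn ℂ (ξ i) J := by
  have : Nonempty ι := ⟨i⟩
  rw [AlgebraicIndepOn, algebraicIndependent_iff]
  refine forall_congr' fun f => imp_congr ?_ Iff.rfl
  have := hξ.aeval_eq_zero_iff i (MvPolynomial.rename Subtype.val f)
  simp only [MvPolynomial.aeval_rename, MvPolynomial.eval_rename] at this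
  exact this.symm

end Generic

theorem Derivation.mem_of_isAlgebraic_adjoin {k L : Type*} [Field k] [Field L] [Algebra k L]
    [CharZero k] (D : Derivation k L L) {M : IntermediateField k L} {S : Set L}
    (hSM : ∀ s ∈ S, s ∈ M) (hD : ∀ s ∈ S, D s ∈ M) {α : L}
    (hα : IsAlgebraic (Algebra.adjoin k S) α) (hαM : α ∈ M) : D α ∈ M := by
  have : CharZero L := charZero_of_injective_algebraMap (algebraMap k L).injective
  have : CharZero (Algebra.adjoin k S) :=
    charZero_of_injective_algebraMap (algebraMap k (Algebra.adjoin k S)).injective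
  have hA : ∀ a ∈ Algebra.adjoin k S, a ∈ M ∧ D a ∈ M := fun a ha => by
    induction ha using Algebra.adjoin_induction with
    | mem x hx => exact ⟨hSM x hx, hD x hx⟩
    | algebraMap r => exact ⟨algebraMap_mem M r, by simp⟩
    | add x y _ _ hx hy => exact ⟨add_mem hx.1 hy.1, by simpa using add_mem hx.2 hy.2⟩
    | mul x y _ _ hx hy =>
      refine ⟨mul_mem hx.1 hy.1, ?_⟩
      rw [D.leibniz]
      exact add_mem (mul_mem hx.1 hy.2) (mul_mem hy.1 hx.2)
  have hP : ∀ P : Polynomial (Algebra.adjoin k S), Polynomial.aeval α P ∈ M ∧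
      ∃ m ∈ M, D (Polynomial.aeval α P) = m + Polynomial.aeval α (Polynomial.derivative P) * D α := by
    intro P
    induction P using Polynomial.induction_on' with
    | add p q hp hq =>
      obtain ⟨h₁, m₁, hm₁, e₁⟩ := hp
      obtain ⟨h₂, m₂, hm₂, e₂⟩ := hq
      refine ⟨by simpa using add_mem h₁ h₂, m₁ + m₂, add_mem hm₁ hm₂, ?_⟩
      rw [map_add, map_add, e₁, e₂, Polynomial.derivative_add, map_add]
      ring
    | monomial n a =>
      have ha := hA a a.2
      refine ⟨?_, α ^ n * D a, mul_mem (pow_mem hαM n) ha.2, ?_⟩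
      · rw [Polynomial.aeval_monomial]
        exact mul_mem ha.1 (pow_mem hαM n)
      · rw [Polynomial.aeval_monomial, D.leibniz, Polynomial.derivative_monomial,
          Polynomial.aeval_monomial, D.leibniz_pow]
        have h : algebraMap (Algebra.adjoin k S) L (a * (n : Algebra.adjoin k S)) = a * n := by
          change ((a * (n : Algebra.adjoin k S) : Algebra.adjoin k S) : L) = _
          push_cast
          rfl
        rw [h]
        simp only [smul_eq_mul, nsmul_eq_mul]
        change (a : L) * _ + _ * D (a : L) = _
        ring
  obtain ⟨P, ⟨hP0, hPα⟩, hmin⟩ := (measure Polynomial.natDegree).wf.has_min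
    {P : Polynomial (Algebra.adjoin k S) | P ≠ 0 ∧ Polynomial.aeval α P = 0} hα
  have hdeg : P.natDegree ≠ 0 := fun h => by
    rw [Polynomial.eq_C_of_natDegree_eq_zero h] at hPα hP0
    simp_all
  have hder : Polynomial.aeval α (Polynomial.derivative P) ≠ 0 := fun h =>
    hmin (Polynomial.derivative P) ⟨fun h0 =>
      hdeg (Polynomial.derivative_eq_zero.1 h0), h⟩
      (Polynomial.natDegree_derivative_lt hdeg)
  obtain ⟨-, m, hm, e⟩ := hP P
  rw [hPα, map_zero] at e
  have : D α = -m / Polynomial.aeval α (Polynomial.derivative P) := by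
    field_simp
    linear_combination -e
  rw [this]
  exact div_mem (neg_mem hm) (hP _).1

/-- The affine tangent directions at the point `q` over the base field `k`. -/
def tangentCone (k : Type*) {κ L : Type*} [Field k] [Field L] [Algebra k L] (q : κ → L) :
    Submodule L (κ → L) :=
  LinearMap.range (LinearMap.coprod
    ({ toFun := fun D j => D (q j), map_add' := fun _ _ => rfl, map_smul' := fun _ _ => rfl } :
      Derivation k L L →ₗ[L] κ → L)
    (LinearMap.toSpanSingleton L (κ → L) q))

theorem derivation_mem_tangentCone {k κ L : Type*} [Field k] [Field L] [Algebra k L] (q : κ → L)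
    (D : Derivation k L L) : (fun j => D (q j)) ∈ tangentCone k q :=
  ⟨(D, 0), by ext; simp⟩

theorem self_mem_tangentCone {k κ L : Type*} [Field k] [Field L] [Algebra k L] (q : κ → L) :
    q ∈ tangentCone k q :=
  ⟨(0, 1), by ext; simp⟩

theorem Submodule.exists_coord_linearIndependent {κ L : Type*} [Finite κ] [Field L]
    (E : Submodule L (κ → L)) :
    ∃ J : Set κ, LinearIndependent L (fun j : J => (LinearMap.proj (j : κ)).comp E.subtype) ∧
      J.ncard = Module.finrank L E := by
  classical
  cases nonempty_fintype κ
  obtain ⟨J, -, -, hspan, hli⟩ := exists_linearIndepOn_extension (K := L)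
    (v := fun j : κ => (LinearMap.proj j : (κ → L) →ₗ[L] L).comp E.subtype)
    (linearIndepOn_empty _ _) (Set.empty_subset Set.univ)
  refine ⟨J, hli, ?_⟩
  have htop : span L (Set.range fun j : J => (LinearMap.proj (j : κ)).comp E.subtype) = ⊤ := by
    rw [eq_top_iff]
    intro φ _
    obtain ⟨ψ, rfl⟩ := LinearMap.exists_extend φ
    have : ψ.comp E.subtype = ∑ j, ψ (Pi.single j 1) •
        (LinearMap.proj j : (κ → L) →ₗ[L] L).comp E.subtype := by
      ext x
      have h1 : ∀ j : κ, (fun i => if j = i then (1 : L) else 0) = Pi.single j 1 := fun j => by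
        ext i
        simp [Pi.single_apply, eq_comm]
      have := LinearMap.pi_apply_eq_sum_univ ψ x
      simp only [h1] at this
      simpa [mul_comm] using this
    rw [this]
    refine sum_mem fun j _ => smul_mem _ _ ?_
    rw [← Set.image_eq_range (f := fun j => (LinearMap.proj (j : κ)).comp E.subtype)]
    exact hspan ⟨j, trivial, rfl⟩
  have hfin : Fintype J := Fintype.ofFinite J
  rw [← Nat.card_coe_set_eq, Nat.card_eq_fintype_card, ← finrank_span_eq_card hli, htop,
    finrank_top]
  exact Subspace.dual_finrank_eq

theorem Derivation.apply_aeval {k σ L : Type*} [Field k] [Field L] [Algebra k L] [Fintype σ]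
    (D : Derivation k L L) (x : σ → L) (f : MvPolynomial σ k) :
    D (MvPolynomial.aeval x f) = ∑ j, MvPolynomial.aeval x (MvPolynomial.pderiv j f) * D (x j) := by
  classical
  induction f using MvPolynomial.induction_on with
  | C a => simp
  | add p q hp hq => simp [hp, hq, add_mul, Finset.sum_add_distrib]
  | mul_X p i hp =>
    simp only [map_mul, D.leibniz, hp, MvPolynomial.aeval_X, Derivation.leibniz,
      MvPolynomial.pderiv_X, smul_eq_mul, map_add, add_mul, Finset.sum_add_distrib,
      Finset.mul_sum]
    congr 1
    · rw [Finset.sum_eq_single i] <;> simp +contextual [eq_comm]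
    · exact Finset.sum_congr rfl fun j _ => by ring

theorem eq_zero_of_isHomogeneous_of_tangentCone {k κ L : Type*} [Field k] [CharZero k] [Field L]
    [Algebra k L] {q : κ → L} {J : Set κ} [Fintype J]
    (hJ : LinearIndependent L
      (fun j : J => (LinearMap.proj (j : κ)).comp (tangentCone k q).subtype))
    {n : ℕ} {f : MvPolynomial J k} (hf : f.IsHomogeneous n)
    (h : MvPolynomial.aeval (fun j : J => q j) f = 0) : f = 0 := by
  induction n generalizing f with
  | zero =>
    rw [← MvPolynomial.totalDegree_zero_iff_isHomogeneous,
      MvPolynomial.totalDegree_eq_zero_iff_eq_C] at hf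
    rw [hf] at h ⊢
    simpa using h
  | succ n ih =>
    have hder : ∀ j, MvPolynomial.pderiv j f = 0 := by
      refine fun j => ih (by simpa using hf.pderiv) ?_
      revert j
      refine Fintype.linearIndependent_iff.1 hJ _ ?_
      ext ⟨_, ⟨D, c⟩, rfl⟩
      have h1 := D.apply_aeval (fun j : J => q j) f
      rw [h, map_zero] at h1
      have h2 := congr_arg (MvPolynomial.aeval fun j : J => q j) hf.sum_X_mul_pderiv
      simp only [map_sum, map_mul, MvPolynomial.aeval_X, map_nsmul, h, smul_zero] at h2
      simp only [LinearMap.sum_apply, LinearMap.smul_apply, LinearMap.comp_apply, 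
        Submodule.subtype_apply, LinearMap.proj_apply, LinearMap.coprod_apply,
        LinearMap.coe_mk, AddHom.coe_mk, LinearMap.toSpanSingleton_apply, Pi.add_apply,
        Pi.smul_apply, smul_eq_mul, mul_add,
        Finset.sum_add_distrib, LinearMap.zero_apply, ← h1, zero_add]
      rw [← mul_zero c, ← h2, Finset.mul_sum]
      exact Finset.sum_congr rfl fun j _ => by ring
    have := hf.sum_X_mul_pderiv
    simp only [hder, mul_zero, Finset.sum_const_zero] at this
    exact (smul_eq_zero.1 this.symm).resolve_left n.succ_ne_zero

theorem exists_linearIndependent_dotProduct_eq_zero {k κ τ L : Type*} [Field k] [Field L]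
    [Algebra k L] [Fintype κ] [Fintype τ] (F : IntermediateField k L) (v : τ → κ → L)
    (hv : ∀ t j, v t j ∈ F) {d : ℕ} (hd : Fintype.card τ + d ≤ Fintype.card κ) :
    ∃ b : Fin d → κ → F, LinearIndependent F b ∧ ∀ s t, ∑ j, (b s j : L) * v t j = 0 := by
  classical
  let A : Matrix τ κ F := fun t j => ⟨v t j, hv t j⟩
  have h1 := LinearMap.finrank_range_add_finrank_ker A.mulVecLin
  have h2 := Submodule.finrank_le (LinearMap.range A.mulVecLin)
  rw [Module.finrank_fintype_fun_eq_card] at h1 h2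
  obtain ⟨b, hb⟩ := exists_linearIndependent_of_le_finrank (R := F)
    (M := LinearMap.ker A.mulVecLin) (n := d) (by omega)
  refine ⟨fun s => b s, hb.map' _ (Submodule.ker_subtype _), fun s t => ?_⟩
  have h3 := congr_arg (algebraMap F L) (congr_fun (LinearMap.mem_ker.1 (b s).2) t)
  simp only [Matrix.mulVecLin_apply, Matrix.mulVec, dotProduct, map_sum, map_mul] at h3
  rw [Pi.zero_apply, map_zero] at h3
  rw [← h3]
  exact Finset.sum_congr rfl fun j _ => mul_comm _ _

section Generic

variable {ι κ L : Type*} [Field L] [Algebra ℂ L] [Fintype κ] {X : Set (κ → ℂ)} {ξ : ι → κ → L}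

theorem IsGenericTuple.notMem_span {τ : Type*} [Fintype τ] (hξ : IsGenericTuple X ξ)
    (hX : X.Nonempty) (hnd : ∀ c : κ → ℂ, (∀ x ∈ X, ∑ j, c j * x j = 0) → c = 0) {i : ι}
    {v : τ → κ → L} (hv : ∀ t j, v t j ∈ othersField ξ i)
    (hcard : Fintype.card τ < Fintype.card κ) : ξ i ∉ Submodule.span L (Set.range v) := by
  intro hmem
  obtain ⟨b, hb, hbv⟩ := exists_linearIndependent_dotProduct_eq_zero _ v hv (d := 1) hcard
  refine hb.ne_zero 0 ?_
  have h : ∑ j, (b 0 j : L) * ξ i j = 0 := by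
    generalize ξ i = y at hmem
    induction hmem using Submodule.span_induction with
    | mem x hx => obtain ⟨t, rfl⟩ := hx; exact hbv 0 t
    | zero => simp
    | add x y _ _ hx hy => simp [mul_add, Finset.sum_add_distrib, hx, hy]
    | smul a x _ hx =>
      simp only [Pi.smul_apply, smul_eq_mul, mul_left_comm _ a]
      rw [← Finset.mul_sum, hx, mul_zero]
  have := hξ.linear_eq_zero hX hnd (fun j => (b 0 j).2) h
  funext j
  exact Subtype.ext (congr_fun this j)

theorem exists_hyperplane_of_forall_sum_eq_zero
    (hX : (MvPolynomial.vanishingIdeal ℂ X).IsPrime) {d : ℕ} (c : ℕ → ℂ) (hc : c d ≠ 0)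
    (u v : κ → ℂ) (h : ∀ x ∈ X, ∑ s ∈ Finset.range (d + 1),
      c s * (∑ j, u j * x j) ^ s * (∑ j, v j * x j) ^ (d - s) = 0) :
    (∀ x ∈ X, ∑ j, v j * x j = 0) ∨ ∃ t : ℂ, ∀ x ∈ X, ∑ j, (u j - t * v j) * x j = 0 := by
  let Q : Polynomial ℂ := ∑ s ∈ Finset.range (d + 1), Polynomial.C (c s) * Polynomial.X ^ s
  have hQ : Q ≠ 0 := fun h0 => hc <| by
    have := congr_arg (Polynomial.coeff · d) h0
    simpa [Q, Polynomial.finsetSum_coeff, Polynomial.coeff_C_mul, Polynomial.coeff_X_pow] using this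
  let f : ℂ → MvPolynomial κ ℂ := fun t =>
    ∑ j, MvPolynomial.C (u j - t * v j) * MvPolynomial.X j
  let g : MvPolynomial κ ℂ := ∑ j, MvPolynomial.C (v j) * MvPolynomial.X j
  have hmem : g * (Q.roots.map f).prod ∈ MvPolynomial.vanishingIdeal ℂ X := by
    rw [MvPolynomial.mem_vanishingIdeal_iff]
    intro x hx
    rw [map_mul, mul_eq_zero, or_iff_not_imp_left]
    intro hg
    have hg' : ∑ j, v j * x j ≠ 0 := by simpa [g] using hg
    rw [map_multiset_prod, Multiset.prod_eq_zero_iff, Multiset.map_map, Multiset.mem_map]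
    refine ⟨(∑ j, u j * x j) / ∑ j, v j * x j, ?_, ?_⟩
    · rw [Polynomial.mem_roots hQ, Polynomial.IsRoot, ← mul_left_inj' (pow_ne_zero d hg'), zero_mul,
        ← h x hx, Polynomial.eval_finsetSum, Finset.sum_mul]
      refine Finset.sum_congr rfl fun s hs => ?_
      have hs' : s ≤ d := Nat.lt_succ_iff.1 (Finset.mem_range.1 hs)
      rw [← Nat.sub_add_cancel hs', pow_add _ (d - s) s]
      simp only [Polynomial.eval_mul, Polynomial.eval_C, Polynomial.eval_pow, Polynomial.eval_X,
        div_pow, Nat.add_sub_cancel]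
      field_simp
    · simp only [f, Function.comp_apply, map_sum, map_mul, MvPolynomial.aeval_C,
        MvPolynomial.aeval_X, Algebra.algebraMap_self, RingHom.id_apply, sub_mul,
        Finset.sum_sub_distrib, mul_assoc]
      rw [← Finset.mul_sum]
      field_simp
      simp
  rcases hX.mem_or_mem hmem with h | h
  · left
    intro x hx
    simpa [g] using h x hx
  · right
    obtain ⟨p, hp, hpX⟩ := (hX.multiset_prod_mem_iff_exists_mem _).1 h
    obtain ⟨t, -, rfl⟩ := Multiset.mem_map.1 hp
    exact ⟨t, fun x hx => by simpa [f] using hpX x hx⟩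

theorem IsGenericTuple.not_isAlgebraic_div (hξ : IsGenericTuple X ξ)
    (hX : (MvPolynomial.vanishingIdeal ℂ X).IsPrime)
    (hnd : ∀ c : κ → ℂ, (∀ x ∈ X, ∑ j, c j * x j = 0) → c = 0) {i : ι}
    {b : Fin 2 → κ → othersField ξ i} (hb : LinearIndependent (othersField ξ i) b) :
    ¬ IsAlgebraic (othersField ξ i)
      ((∑ j, (b 0 j : L) * ξ i j) / ∑ j, (b 1 j : L) * ξ i j) := by
  classical
  have hne : X.Nonempty := by
    by_contra h
    rw [Set.not_nonempty_iff_eq_empty] at h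
    exact hX.ne_top (Ideal.eq_top_iff_one _ |>.2 fun x hx => by simp [h] at hx)
  have hminor : ∃ j j', b 0 j * b 1 j' - b 0 j' * b 1 j ≠ 0 := by
    by_contra! h
    have h1 := hb.ne_zero 1
    obtain ⟨j', hj'⟩ := Function.ne_iff.1 h1
    have := Fintype.linearIndependent_iff.1 hb ![b 1 j', - b 0 j'] (by
      ext j
      simp only [Fin.sum_univ_two, Pi.add_apply, Pi.smul_apply, smul_eq_mul, Matrix.cons_val_zero,
        Matrix.cons_val_one, Pi.zero_apply]
      have := congr_arg Subtype.val (h j j')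
      push_cast at this ⊢
      linear_combination this) 0
    exact hj' (by simpa using this)
  obtain ⟨j₀, j₁, hj⟩ := hminor
  have hμ : ∑ j, (b 1 j : L) * ξ i j ≠ 0 := fun h0 =>
    hb.ne_zero 1 <| funext fun j => Subtype.ext
      (congr_fun (hξ.linear_eq_zero hne hnd (fun j => (b 1 j).2) h0) j)
  rintro ⟨P, hP0, hP⟩
  set d := P.natDegree
  obtain ⟨δ, C, hδ, hC⟩ := exists_common_denominator
    (fun x : {x : ι × κ // x.1 ≠ i} => ξ x.1.1 x.1.2)
    (Sum.elim (fun s : Fin (d + 1) => (P.coeff s : L)) (fun x : Fin 2 × κ => (b x.1 x.2 : L)))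
    (by rintro (s | x) <;> exact Subtype.prop _)
  let a : ℕ → MvPolynomial {x : ι × κ // x.1 ≠ i} ℂ := fun s =>
    if h : s < d + 1 then C (.inl ⟨s, h⟩) else 0
  have ha : ∀ s ∈ Finset.range (d + 1), MvPolynomial.aeval
      (fun x : {x : ι × κ // x.1 ≠ i} => ξ x.1.1 x.1.2) (a s) = δ * (P.coeff s : L) := by
    intro s hs
    simp only [a, dif_pos (Finset.mem_range.1 hs), ← hC]
    rfl
  have hB : ∀ s j, MvPolynomial.aeval (fun x : {x : ι × κ // x.1 ≠ i} => ξ x.1.1 x.1.2)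
      (C (.inr (s, j))) = δ * (b s j : L) := fun s j => (hC _).symm
  have hne0 : ¬ ∀ p : ι → κ → ℂ, (∀ i, p i ∈ X) → evalOthers p i (a d *
      (C (.inr (0, j₀)) * C (.inr (1, j₁)) - C (.inr (0, j₁)) * C (.inr (1, j₀)))) = 0 := by
    rw [← hξ.aeval_others_eq_zero_iff hne, map_mul, map_sub, map_mul, map_mul,
      ha d (Finset.self_mem_range_succ d)]
    simp only [hB]
    have hlead : (P.coeff d : L) ≠ 0 := by simpa [d] using hP0
    have hj' : (b 0 j₀ * b 1 j₁ - b 0 j₁ * b 1 j₀ : L) ≠ 0 := fun h =>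
      hj (Subtype.ext (by simpa using h))
    refine mul_ne_zero (mul_ne_zero hδ hlead) ?_
    convert mul_ne_zero (mul_ne_zero hδ hδ) hj' using 1
    ring
  push Not at hne0
  obtain ⟨p, hp, hp0⟩ := hne0
  rw [map_mul, map_sub, map_mul, map_mul, mul_ne_zero_iff] at hp0
  have key : ∀ x ∈ X, ∑ s ∈ Finset.range (d + 1), evalOthers p i (a s) *
      (∑ j, evalOthers p i (C (.inr (0, j))) * x j) ^ s *
      (∑ j, evalOthers p i (C (.inr (1, j))) * x j) ^ (d - s) = 0 := by
    intro x hx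
    have := (hξ (∑ s ∈ Finset.range (d + 1), MvPolynomial.rename Subtype.val (a s) *
      (∑ j, MvPolynomial.rename Subtype.val (C (.inr (0, j))) * MvPolynomial.X (i, j)) ^ s *
      (∑ j, MvPolynomial.rename Subtype.val (C (.inr (1, j))) * MvPolynomial.X (i, j)) ^ (d - s))).1
      ?_ (Function.update p i x) ?_
    · rw [← evalOthers_update p i x]
      simpa [MvPolynomial.eval_rename, evalOthers, Function.comp_def] using this
    · simp only [map_sum, map_mul, map_pow, MvPolynomial.aeval_rename, MvPolynomial.aeval_X]
      change ∑ s ∈ Finset.range (d + 1), MvPolynomial.aeval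
        (fun x : {x : ι × κ // x.1 ≠ i} => ξ x.1.1 x.1.2) (a s) *
        (∑ j, MvPolynomial.aeval (fun x : {x : ι × κ // x.1 ≠ i} => ξ x.1.1 x.1.2)
          (C (.inr (0, j))) * ξ i j) ^ s *
        (∑ j, MvPolynomial.aeval (fun x : {x : ι × κ // x.1 ≠ i} => ξ x.1.1 x.1.2)
          (C (.inr (1, j))) * ξ i j) ^ (d - s) = 0
      simp only [hB, mul_assoc, ← Finset.mul_sum]
      rw [Polynomial.aeval_eq_sum_range] at hP
      have h2 := congr_arg (δ ^ (d + 1) * (∑ j, (b 1 j : L) * ξ i j) ^ d * ·) hP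
      simp only [mul_zero, Finset.mul_sum] at h2
      rw [← h2]
      refine Finset.sum_congr rfl fun s hs => ?_
      have hs' : s ≤ d := Nat.lt_succ_iff.1 (Finset.mem_range.1 hs)
      rw [ha s hs, Algebra.smul_def, div_pow, mul_pow, mul_pow]
      obtain ⟨e, he⟩ := Nat.exists_eq_add_of_le hs'
      rw [he, Nat.add_sub_cancel_left, pow_add _ s e, pow_succ, pow_add _ s e]
      field_simp
      exact mul_comm _ _
    · intro i'
      by_cases hi : i' = i
      · subst hi; simpa
      · simpa [hi] using hp i'
  rcases exists_hyperplane_of_forall_sum_eq_zero hX (fun s => evalOthers p i (a s)) hp0.1 _ _ key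
    with h | ⟨t, h⟩
  · have := congr_fun (hnd _ h)
    exact hp0.2 (by simp [this])
  · have h3 := congr_fun (hnd _ h)
    refine hp0.2 ?_
    have h4 := h3 j₀
    have h5 := h3 j₁
    simp only [Pi.zero_apply] at h4 h5
    linear_combination evalOthers p i (C (.inr (1, j₁))) * h4 -
      evalOthers p i (C (.inr (1, j₀))) * h5

end Generic

theorem MvPolynomial.IsHomogeneous.eval_smul {σ R : Type*} [CommSemiring R] {f : MvPolynomial σ R}
    {n : ℕ} (hf : f.IsHomogeneous n) (c : R) (x : σ → R) :
    MvPolynomial.eval (c • x) f = c ^ n * MvPolynomial.eval x f := by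
  rw [MvPolynomial.eval_eq, MvPolynomial.eval_eq, Finset.mul_sum]
  refine Finset.sum_congr rfl fun d hd => ?_
  have hdn : ∑ i ∈ d.support, d i = n := by
    have := hf (MvPolynomial.mem_support_iff.1 hd)
    simpa [Finsupp.weight_apply, Finsupp.sum] using this
  simp only [Pi.smul_apply, smul_eq_mul, mul_pow, Finset.prod_mul_distrib,
    Finset.prod_pow_eq_pow_sum, hdn]
  ring

theorem eval_homogeneousComponent_eq_zero {κ : Type*} {X : Set (κ → ℂ)}
    (hcone : ∀ (c : ℂ) (x : κ → ℂ), x ∈ X → c • x ∈ X) {f : MvPolynomial κ ℂ}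
    (hf : ∀ x ∈ X, MvPolynomial.eval x f = 0) (n : ℕ) {x : κ → ℂ} (hx : x ∈ X) :
    MvPolynomial.eval x (MvPolynomial.homogeneousComponent n f) = 0 := by
  have h : ∑ s ∈ Finset.range (f.totalDegree + 1), Polynomial.C
      (MvPolynomial.eval x (MvPolynomial.homogeneousComponent s f)) * Polynomial.X ^ s = 0 := by
    refine Polynomial.funext fun c => ?_
    rw [Polynomial.eval_zero, ← hf _ (hcone c x hx)]
    conv_rhs => rw [← MvPolynomial.sum_homogeneousComponent f]
    rw [Polynomial.eval_finsetSum, map_sum]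
    refine Finset.sum_congr rfl fun s _ => ?_
    rw [(MvPolynomial.homogeneousComponent_isHomogeneous s f).eval_smul]
    rw [Polynomial.eval_mul, Polynomial.eval_C, Polynomial.eval_pow, Polynomial.eval_X, mul_comm]
  by_cases hn : n < f.totalDegree + 1
  · have := congr_arg (Polynomial.coeff · n) h
    simp only [Polynomial.finsetSum_coeff, Polynomial.coeff_C_mul, Polynomial.coeff_X_pow,
      mul_ite, mul_one, mul_zero, Finset.sum_ite_eq, Polynomial.coeff_zero] at this
    rwa [if_pos (Finset.mem_range.2 hn)] at this
  · rw [MvPolynomial.homogeneousComponent_eq_zero n f (by omega), map_zero]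

theorem exists_coordIndepOn_ncard_eq_finrank_tangentCone {κ L : Type*} [Finite κ] [Field L]
    [Algebra ℂ L] {X : Set (κ → ℂ)} (hcone : ∀ (c : ℂ) (x : κ → ℂ), x ∈ X → c • x ∈ X)
    {q : κ → L} (hq : ∀ f : MvPolynomial κ ℂ, (∀ x ∈ X, MvPolynomial.eval x f = 0) →
      MvPolynomial.aeval q f = 0) :
    ∃ J, CoordIndepOn X J ∧ J.ncard = Module.finrank L (tangentCone ℂ q) := by
  obtain ⟨J, hJ, hcard⟩ := (tangentCone ℂ q).exists_coord_linearIndependent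
  refine ⟨J, fun f hf => ?_, hcard⟩
  have := Fintype.ofFinite J
  rw [← MvPolynomial.sum_homogeneousComponent f]
  refine Finset.sum_eq_zero fun n _ => eq_zero_of_isHomogeneous_of_tangentCone hJ
    (MvPolynomial.homogeneousComponent_isHomogeneous n f) ?_
  have h1 := hq (MvPolynomial.homogeneousComponent n (MvPolynomial.rename Subtype.val f))
    fun x hx => eval_homogeneousComponent_eq_zero hcone
      (fun x hx => by simpa [MvPolynomial.eval_rename, Function.comp_def] using hf x hx) n hx
  rw [← MvPolynomial.rename_homogeneousComponent, MvPolynomial.aeval_rename] at h1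
  exact h1

section Generic

variable {ι κ L : Type*} [Field L] [Algebra ℂ L] {X : Set (κ → ℂ)} {ξ : ι → κ → L}

theorem IsGenericTuple.exists_dual_derivation [Finite κ] (hξ : IsGenericTuple X ξ) (hX : X.Nonempty)
    {J : Set κ} (hJ : CoordIndepOn X J)
    (hmax : ∀ J', CoordIndepOn X J' → J'.ncard ≤ J.ncard) (i : ι) (j : J) :
    ∃ D : Derivation (othersField ξ i) L L, D (ξ i j) = 1 ∧ (∀ l : J, l ≠ j → D (ξ i l) = 0) ∧
      ∀ i' ≠ i, ∀ l, D (ξ i l) ∈ othersField ξ i' := by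
  classical
  obtain ⟨D, hD⟩ := (hξ.algebraicIndependent hX hJ i).exists_derivation
    (fun l => if l = j then 1 else 0)
  refine ⟨D, by simp [hD], fun l hl => by simp [hD, hl], fun i' hi' l => ?_⟩
  have hval : ∀ s ∈ ξ i '' J, D s ∈ othersField ξ i' := by
    rintro _ ⟨l, hl, rfl⟩
    rw [hD ⟨l, hl⟩]
    split_ifs
    exacts [one_mem _, zero_mem _]
  by_cases hl : l ∈ J
  · exact hval _ ⟨l, hl, rfl⟩
  have halg : IsAlgebraic (Algebra.adjoin ℂ (ξ i '' J)) (ξ i l) := by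
    by_contra htr
    have h := hmax (insert l J) ((hξ.coordIndepOn_iff i).2
      (((hξ.coordIndepOn_iff i).1 hJ).insert htr))
    rw [Set.ncard_insert_of_notMem hl] at h
    omega
  exact (D.restrictScalars ℂ).mem_of_isAlgebraic_adjoin
    (by rintro _ ⟨l, -, rfl⟩; exact mem_othersField ξ hi'.symm l) hval halg
    (mem_othersField ξ hi'.symm l)

/-- Derivations over the field of the other points move a point inside the span of the affine
tangent cone at a secant point and of the tuple. -/
theorem derivation_mem_tangentCone_sup_span [Fintype ι] {a : ι → L} {i : ι} (ha : a i ≠ 0)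
    (D : Derivation (othersField ξ i) L L) :
    (fun j => D (ξ i j)) ∈ tangentCone ℂ (∑ l, a l • ξ l) ⊔ Submodule.span L (Set.range ξ) := by
  classical
  have h : (fun j => D (ξ i j)) = (a i)⁻¹ • ((fun j => (D.restrictScalars ℂ) ((∑ l, a l • ξ l) j)) -
      ∑ l, D (a l) • ξ l) := by
    funext j
    have h1 : D ((∑ l, a l • ξ l) j) = ∑ l, (a l * D (ξ l j) + ξ l j * D (a l)) := by
      simp [Finset.sum_apply]
    have h2 : ∑ l, a l * D (ξ l j) = a i * D (ξ i j) := by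
      refine Finset.sum_eq_single i (fun l _ hl => ?_) (by simp)
      have : D (ξ l j) = 0 := D.map_algebraMap ⟨ξ l j, mem_othersField ξ hl j⟩
      rw [this, mul_zero]
    rw [Finset.sum_add_distrib, h2] at h1
    simp only [Pi.smul_apply, Pi.sub_apply, Finset.sum_apply, smul_eq_mul,
      Derivation.restrictScalars_apply] at h1 ⊢
    rw [h1]
    simp only [mul_comm (ξ _ j)]
    field_simp
    simp
  rw [h]
  exact Submodule.smul_mem _ _ (sub_mem
    (Submodule.mem_sup_left (derivation_mem_tangentCone _ _))
    (Submodule.mem_sup_right (sum_mem fun l _ => Submodule.smul_mem _ _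
      (Submodule.subset_span ⟨l, rfl⟩))))

theorem finrank_tangentCone_sup_span_lt [Finite κ] [Fintype ι] {a : ι → L} (hq : ∑ l, a l • ξ l ≠ 0) :
    Module.finrank L
      (tangentCone ℂ (∑ l, a l • ξ l) ⊔ Submodule.span L (Set.range ξ) : Submodule L (κ → L)) <
      Module.finrank L (tangentCone ℂ (∑ l, a l • ξ l)) + Fintype.card ι := by
  have h1 := Submodule.finrank_sup_add_finrank_inf_eq (tangentCone ℂ (∑ l, a l • ξ l))
    (Submodule.span L (Set.range ξ))
  have h2 := finrank_range_le_card (R := L) ξ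
  have h3 : 0 < Module.finrank L
      (tangentCone ℂ (∑ l, a l • ξ l) ⊓ Submodule.span L (Set.range ξ) : Submodule L (κ → L)) := by
    rw [Module.finrank_pos_iff_exists_ne_zero]
    refine ⟨⟨_, self_mem_tangentCone _, sum_mem fun l _ => Submodule.smul_mem _ _
      (Submodule.subset_span ⟨l, rfl⟩)⟩, fun h => hq (congr_arg Subtype.val h)⟩
  rw [Set.finrank] at h2
  omega

theorem IsGenericTuple.linearIndependent_sumElim [Fintype κ] [Fintype ι] (hξ : IsGenericTuple X ξ)
    (hX : X.Nonempty) (hnd : ∀ c : κ → ℂ, (∀ x ∈ X, ∑ j, c j * x j = 0) → c = 0)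
    {τ : Type*} [Fintype τ] {i : ι} {w : τ → κ → L} (hw : LinearIndependent L w)
    (hwF : ∀ i' ≠ i, ∀ t j, w t j ∈ othersField ξ i')
    (hcard : Fintype.card τ + Fintype.card ι ≤ Fintype.card κ + 1) :
    LinearIndependent L (Sum.elim w fun l : {l // l ≠ i} => ξ l) := by
  classical
  rw [Fintype.linearIndependent_iff]
  intro g hg
  simp only [Fintype.sum_sum_type, Sum.elim_inl, Sum.elim_inr] at hg
  have hr : ∀ l : {l // l ≠ i}, g (.inr l) = 0 := by
    intro l
    by_contra hl
    refine hξ.notMem_span hX hnd (i := l) (τ := τ ⊕ {l' : {l // l ≠ i} // l' ≠ l})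
      (v := Sum.elim w fun l' => ξ l'.1) ?_ ?_ ?_
    · rintro (t | l') j
      · exact hwF l l.2 t j
      · exact mem_othersField ξ (fun h => l'.2 (Subtype.ext h)) j
    · have h1 : Fintype.card {l // l ≠ i} = Fintype.card ι - 1 := Set.card_ne_eq i
      have h2 : Fintype.card {l' : {l // l ≠ i} // l' ≠ l} = Fintype.card {l // l ≠ i} - 1 :=
        Set.card_ne_eq l
      have h3 : 1 < Fintype.card ι := Fintype.one_lt_card_iff.2 ⟨l, i, l.2⟩
      rw [Fintype.card_sum]
      omega
    · rw [← Finset.add_sum_erase _ _ (Finset.mem_univ l)] at hg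
      have h1 : ξ l = -(g (.inr l))⁻¹ • (∑ t, g (.inl t) • w t +
          ∑ l' ∈ Finset.univ.erase l, g (.inr l') • ξ l') := by
        rw [neg_smul, ← smul_neg, eq_inv_smul_iff₀ hl]
        linear_combination (exp := 1) hg
      rw [h1]
      refine Submodule.smul_mem _ _ (add_mem (sum_mem fun t _ => Submodule.smul_mem _ _
        (Submodule.subset_span ⟨.inl t, rfl⟩)) (sum_mem fun l' hl' => Submodule.smul_mem _ _
        (Submodule.subset_span ⟨.inr ⟨l', Finset.ne_of_mem_erase hl'⟩, rfl⟩)))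
  simp only [hr, zero_smul, Finset.sum_const_zero, add_zero] at hg
  rintro (t | l)
  exacts [Fintype.linearIndependent_iff.1 hw _ hg t, hr l]

theorem IsGenericTuple.false_of_mem_secant [Fintype κ] [Fintype ι] (hξ : IsGenericTuple X ξ)
    (hX : (MvPolynomial.vanishingIdeal ℂ X).IsPrime) (hne : X.Nonempty)
    (hcone : ∀ (c : ℂ) (x : κ → ℂ), x ∈ X → c • x ∈ X)
    (hnd : ∀ c : κ → ℂ, (∀ x ∈ X, ∑ j, c j * x j = 0) → c = 0)
    (hcard : ∀ J, CoordIndepOn X J → J.ncard + Fintype.card ι ≤ Fintype.card κ)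
    {a : ι → L} {i₀ i₁ : ι} (hi : i₀ ≠ i₁) (h₀ : a i₀ ≠ 0) (h₁ : a i₁ ≠ 0)
    (hq0 : ∑ l, a l • ξ l ≠ 0)
    (hq : ∀ f : MvPolynomial κ ℂ, (∀ x ∈ X, MvPolynomial.eval x f = 0) →
      MvPolynomial.aeval (∑ l, a l • ξ l) f = 0) : False := by
  classical
  obtain ⟨J', hJ', he⟩ := exists_coordIndepOn_ncard_eq_finrank_tangentCone hcone hq
  obtain ⟨J, hJ, hmax⟩ := Set.exists_max_image {J | CoordIndepOn X J} Set.ncard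
    (Set.toFinite _) ⟨J', hJ'⟩
  have hJe := hmax J' hJ'
  have hJc := hcard J hJ
  have hJcard : Fintype.card J = J.ncard := by rw [← Nat.card_coe_set_eq, Nat.card_eq_fintype_card]
  choose D hD1 hD0 hDF using hξ.exists_dual_derivation hne hJ hmax i₀
  let w : J → κ → L := fun j l => D j (ξ i₀ l)
  have hw : LinearIndependent L w := by
    rw [Fintype.linearIndependent_iff]
    intro g hg j
    have := congr_fun hg j
    rw [Finset.sum_apply, Finset.sum_eq_single j] at this
    · simpa [w, hD1] using this
    · intro l _ hl
      simp [w, hD0 l j hl.symm]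
    · simp
  have hu := hξ.linearIndependent_sumElim hne hnd hw (fun i' hi' j l => hDF j i' hi' l) (by omega)
  have hι : Fintype.card {l // l ≠ i₀} = Fintype.card ι - 1 := Set.card_ne_eq i₀
  have hι' : Fintype.card {l : {l // l ≠ i₀} // l ≠ ⟨i₁, hi.symm⟩} =
      Fintype.card {l // l ≠ i₀} - 1 := Set.card_ne_eq (⟨i₁, hi.symm⟩ : {l // l ≠ i₀})
  have hι2 : 1 < Fintype.card ι := Fintype.one_lt_card_iff.2 ⟨_, _, hi⟩
  have hspan : Submodule.span L (Set.range (Sum.elim w fun l : {l // l ≠ i₀} => ξ l)) =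
      tangentCone ℂ (∑ l, a l • ξ l) ⊔ Submodule.span L (Set.range ξ) := by
    refine Submodule.eq_of_le_of_finrank_le (Submodule.span_le.2 ?_) ?_
    · rintro _ ⟨j | l, rfl⟩
      · exact derivation_mem_tangentCone_sup_span h₀ (D j)
      · exact Submodule.mem_sup_right (Submodule.subset_span ⟨l, rfl⟩)
    · have h := finrank_tangentCone_sup_span_lt hq0
      rw [finrank_span_eq_card hu, Fintype.card_sum]
      omega
  obtain ⟨b, hb, hbv⟩ := exists_linearIndependent_dotProduct_eq_zero (othersField ξ i₁)
    (Sum.elim w fun l : {l : {l // l ≠ i₀} // l ≠ ⟨i₁, hi.symm⟩} => ξ l.1) (by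
      rintro (j | l) t
      · exact hDF j i₁ hi.symm t
      · exact mem_othersField ξ (fun h => l.2 (Subtype.ext h)) t) (d := 2) (by
      rw [Fintype.card_sum]
      omega)
  have hprop : ∀ u ∈ Submodule.span L (Set.range (Sum.elim w fun l : {l // l ≠ i₀} => ξ l)),
      (∑ j, (b 0 j : L) * u j) * (∑ j, (b 1 j : L) * ξ i₁ j) =
      (∑ j, (b 1 j : L) * u j) * (∑ j, (b 0 j : L) * ξ i₁ j) := by
    intro u hu
    induction hu using Submodule.span_induction with
    | mem x hx =>
      obtain ⟨j | l, rfl⟩ := hx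
      · have h0 := hbv 0 (.inl j)
        have h1 := hbv 1 (.inl j)
        simp only [Sum.elim_inl] at h0 h1 ⊢
        rw [h0, h1, zero_mul, zero_mul]
      · by_cases hl : l = ⟨i₁, hi.symm⟩
        · subst hl
          exact mul_comm _ _
        · have h0 := hbv 0 (.inr ⟨l, hl⟩)
          have h1 := hbv 1 (.inr ⟨l, hl⟩)
          simp only [Sum.elim_inr] at h0 h1 ⊢
          rw [h0, h1, zero_mul, zero_mul]
    | zero => simp
    | add x y _ _ hx hy =>
      simp only [Pi.add_apply, mul_add, add_mul, Finset.sum_add_distrib, hx, hy]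
    | smul c x _ hx =>
      simp only [Pi.smul_apply, smul_eq_mul, mul_left_comm _ c]
      rw [← Finset.mul_sum, ← Finset.mul_sum, mul_assoc, mul_assoc, hx]
  refine hξ.not_isAlgebraic_div hX hnd hb (isAlgebraic_of_forall_derivation_eq_zero fun Δ => ?_)
  have hΔ : ∀ s, Δ (∑ j, (b s j : L) * ξ i₁ j) = ∑ j, (b s j : L) * Δ (ξ i₁ j) := fun s => by
    rw [map_sum]
    refine Finset.sum_congr rfl fun j _ => ?_
    have : Δ (b s j : L) = 0 := Δ.map_algebraMap (b s j)
    rw [Δ.leibniz, this, smul_zero, add_zero, smul_eq_mul]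
  have := hprop _ (hspan ▸ derivation_mem_tangentCone_sup_span h₁ Δ)
  rw [Derivation.leibniz_div, hΔ, hΔ]
  simp only [smul_eq_mul]
  rw [mul_comm (∑ j, (b 1 j : L) * ξ i₁ j), this, mul_comm, sub_eq_zero.2 (mul_comm _ _), zero_mul]

end Generic

theorem Ultrafilter.exists_algHom_field {Ω : Type u} (φ : Ultrafilter Ω) (k : Type v) [Field k] :
    ∃ (L : Type (max u v)) (_ : Field L) (_ : Algebra k L) (π : (Ω → k) →ₐ[k] L),
      ∀ f, π f = 0 ↔ ∀ᶠ ω in φ, f ω = 0 := by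
  let π := Filter.Germ.coeRingHom (R := k) (φ : Filter Ω)
  let alg : Algebra k (Filter.Germ (φ : Filter Ω) k) := (π.comp (algebraMap k (Ω → k))).toAlgebra
  exact ⟨Filter.Germ (φ : Filter Ω) k, inferInstance, alg,
    { π with commutes' := fun _ => rfl }, fun f => Filter.Germ.coe_eq (g := fun _ => (0 : k))⟩

theorem MvPolynomial.aeval_algHom_pi {Ω σ k L : Type*} [Field k] [Field L] [Algebra k L]
    (π : (Ω → k) →ₐ[k] L) (y : σ → Ω → k) (f : MvPolynomial σ k) :
    MvPolynomial.aeval (fun s => π (y s)) f =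
      π fun ω => MvPolynomial.eval (fun s => y s ω) f := by
  have h : (MvPolynomial.aeval fun s => π (y s)) = π.comp (MvPolynomial.aeval y) :=
    MvPolynomial.algHom_ext fun s => by simp
  rw [h, AlgHom.comp_apply]
  congr 1
  funext ω
  change Pi.evalAlgHom k (fun _ : Ω => k) ω (MvPolynomial.aeval y f) = MvPolynomial.aeval _ f
  rw [← AlgHom.comp_apply, MvPolynomial.comp_aeval]
  rfl

theorem exists_mem_pow_eval_ne_zero {ι κ : Type*} [Finite ι] {X : Set (κ → ℂ)}
    (hX : (MvPolynomial.vanishingIdeal ℂ X).IsPrime) {f g : MvPolynomial (ι × κ) ℂ}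
    {p p' : ι → κ → ℂ} (hp : ∀ i, p i ∈ X) (hp' : ∀ i, p' i ∈ X)
    (hf : MvPolynomial.eval (fun x => p x.1 x.2) f ≠ 0)
    (hg : MvPolynomial.eval (fun x => p' x.1 x.2) g ≠ 0) :
    ∃ p : ι → κ → ℂ, (∀ i, p i ∈ X) ∧ MvPolynomial.eval (fun x => p x.1 x.2) f ≠ 0 ∧
      MvPolynomial.eval (fun x => p x.1 x.2) g ≠ 0 := by
  classical
  cases nonempty_fintype ι
  have key : ∀ s : Finset ι, ∃ p p' : ι → κ → ℂ, (∀ i, p i ∈ X) ∧ (∀ i, p' i ∈ X) ∧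
      MvPolynomial.eval (fun x => p x.1 x.2) f ≠ 0 ∧
      MvPolynomial.eval (fun x => p' x.1 x.2) g ≠ 0 ∧ ∀ i ∈ s, p i = p' i := by
    intro s
    induction s using Finset.induction_on with
    | empty => exact ⟨p, p', hp, hp', hf, hg, by simp⟩
    | insert i s hi ih =>
      obtain ⟨p, p', hp, hp', hf, hg, hs⟩ := ih
      let F (p : ι → κ → ℂ) : MvPolynomial (ι × κ) ℂ →ₐ[ℂ] MvPolynomial κ ℂ := MvPolynomial.aeval
        fun x => if x.1 = i then MvPolynomial.X x.2 else MvPolynomial.C (p x.1 x.2)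
      have hF : ∀ (p : ι → κ → ℂ) f x, MvPolynomial.aeval x (F p f) =
          MvPolynomial.eval (fun y => Function.update p i x y.1 y.2) f := by
        intro p f x
        rw [← AlgHom.comp_apply, MvPolynomial.comp_aeval, ← MvPolynomial.coe_aeval_eq_eval]
        change MvPolynomial.aeval _ f = MvPolynomial.aeval _ f
        congr 2
        funext y
        by_cases hy : y.1 = i <;> simp [hy]
      have h1 : F p f * F p' g ∉ MvPolynomial.vanishingIdeal ℂ X := by
        refine hX.mul_notMem (fun h => hf ?_) fun h => hg ?_
        · have := h _ (hp i)
          rwa [hF, Function.update_eq_self] at this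
        · have := h _ (hp' i)
          rwa [hF, Function.update_eq_self] at this
      rw [MvPolynomial.mem_vanishingIdeal_iff] at h1
      push Not at h1
      obtain ⟨x, hx, hne⟩ := h1
      rw [map_mul, hF, hF, mul_ne_zero_iff] at hne
      have hup : ∀ p : ι → κ → ℂ, (∀ i, p i ∈ X) → ∀ i', Function.update p i x i' ∈ X := by
        intro p hp i'
        by_cases h : i' = i
        · subst h; simpa
        · simpa [h] using hp i'
      refine ⟨_, _, hup p hp, hup p' hp', hne.1, hne.2, fun i' hi' => ?_⟩
      by_cases h : i' = i
      · subst h; simp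
      · simpa [h] using hs i' (Finset.mem_of_mem_insert_of_ne hi' h)
  obtain ⟨p, p', hp, -, hf, hg, h⟩ := key Finset.univ
  obtain rfl : p = p' := funext fun i => h i (Finset.mem_univ i)
  exact ⟨p, hp, hf, hg⟩

theorem exists_ultrafilter_generic {ι κ : Type*} [Finite ι] {X : Set (κ → ℂ)}
    (hX : (MvPolynomial.vanishingIdeal ℂ X).IsPrime) (hne : X.Nonempty) {B : Set (ι → κ → ℂ)}
    (hB : ∀ g : MvPolynomial (ι × κ) ℂ, (∀ p ∈ B, MvPolynomial.eval (fun x => p x.1 x.2) g = 0) →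
      ∀ p : ι → κ → ℂ, (∀ i, p i ∈ X) → MvPolynomial.eval (fun x => p x.1 x.2) g = 0) :
    ∃ φ : Ultrafilter (ι → κ → ℂ), ∀ g : MvPolynomial (ι × κ) ℂ, ∀ p : ι → κ → ℂ,
      (∀ i, p i ∈ X) → MvPolynomial.eval (fun x => p x.1 x.2) g ≠ 0 →
      ∀ᶠ p in φ, p ∈ B ∧ MvPolynomial.eval (fun x => p x.1 x.2) g ≠ 0 := by
  classical
  obtain ⟨x₀, hx₀⟩ := hne
  suffices h : ∀ T : Finset (Set (ι → κ → ℂ)), (T : Set (Set (ι → κ → ℂ))) ⊆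
      {s | ∃ g : MvPolynomial (ι × κ) ℂ, (∃ p : ι → κ → ℂ, (∀ i, p i ∈ X) ∧
      MvPolynomial.eval (fun x => p x.1 x.2) g ≠ 0) ∧
      s = {p | p ∈ B ∧ MvPolynomial.eval (fun x => p x.1 x.2) g ≠ 0}} →
      (⋂₀ (T : Set (Set (ι → κ → ℂ)))).Nonempty by
    obtain ⟨φ, hφ⟩ := Ultrafilter.exists_ultrafilter_of_finite_inter_nonempty _ h
    exact ⟨φ, fun g p hp hg => hφ ⟨g, ⟨p, hp, hg⟩, rfl⟩⟩
  intro T hT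
  have key : ∃ g : MvPolynomial (ι × κ) ℂ, (∃ p : ι → κ → ℂ, (∀ i, p i ∈ X) ∧
      MvPolynomial.eval (fun x => p x.1 x.2) g ≠ 0) ∧
      {p | p ∈ B ∧ MvPolynomial.eval (fun x => p x.1 x.2) g ≠ 0} ⊆ ⋂₀ (T : Set (Set _)) := by
    induction T using Finset.induction_on with
    | empty => exact ⟨1, ⟨fun _ => x₀, fun _ => hx₀, by simp⟩, by simp⟩
    | insert s T hs ih =>
      rw [Finset.coe_insert, Set.insert_subset_iff] at hT
      obtain ⟨g, ⟨p, hp, hg⟩, hgT⟩ := ih hT.2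
      obtain ⟨f, ⟨p', hp', hf⟩, rfl⟩ := hT.1
      obtain ⟨p'', hp'', h1, h2⟩ := exists_mem_pow_eval_ne_zero hX hp hp' hg hf
      refine ⟨g * f, ⟨p'', hp'', by simp [h1, h2]⟩, ?_⟩
      rw [Finset.coe_insert, Set.sInter_insert]
      rintro p ⟨hpB, hpne⟩
      rw [map_mul, mul_ne_zero_iff] at hpne
      exact ⟨⟨hpB, hpne.2⟩, hgT ⟨hpB, hpne.1⟩⟩
  obtain ⟨g, ⟨p, hp, hg⟩, hgT⟩ := key
  by_contra hemp
  refine hg (hB g (fun p hpB => ?_) p hp)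
  by_contra hne
  exact hemp ⟨p, hgT ⟨hpB, hne⟩⟩

theorem false_of_dense_bad_tuples {ι κ : Type*} [Fintype ι] [Fintype κ] {X : Set (κ → ℂ)}
    (hX : (MvPolynomial.vanishingIdeal ℂ X).IsPrime) (hne : X.Nonempty)
    (hcone : ∀ (c : ℂ) (x : κ → ℂ), x ∈ X → c • x ∈ X)
    (hnd : ∀ c : κ → ℂ, (∀ x ∈ X, ∑ j, c j * x j = 0) → c = 0)
    (hcard : ∀ J, CoordIndepOn X J → J.ncard + Fintype.card ι ≤ Fintype.card κ)
    {B : Set (ι → κ → ℂ)} (hBX : ∀ p ∈ B, ∀ i, p i ∈ X)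
    (hB : ∀ g : MvPolynomial (ι × κ) ℂ, (∀ p ∈ B, MvPolynomial.eval (fun x => p x.1 x.2) g = 0) →
      ∀ p : ι → κ → ℂ, (∀ i, p i ∈ X) → MvPolynomial.eval (fun x => p x.1 x.2) g = 0)
    (hbad : ∀ p ∈ B, (∃ i j, i ≠ j ∧ ∃ c : ℂ, p i = c • p j) ∨
      ∃ i j, i ≠ j ∧ ∃ a : ι → ℂ, a i ≠ 0 ∧ a j ≠ 0 ∧ ∑ l, a l • p l ≠ 0 ∧ ∑ l, a l • p l ∈ X) :
    False := by
  classical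
  obtain ⟨φ, hφ⟩ := exists_ultrafilter_generic hX hne hB
  obtain ⟨x₀, hx₀⟩ := hne
  have hφB : ∀ᶠ p in φ, p ∈ B := (hφ 1 (fun _ => x₀) (fun _ => hx₀) (by simp)).mono fun _ h => h.1
  obtain ⟨L, _, _, π, hπ⟩ := φ.exists_algHom_field ℂ
  let ξ : ι → κ → L := fun i j => π fun p => p i j
  have hξ : IsGenericTuple X ξ := by
    intro g
    rw [MvPolynomial.aeval_algHom_pi π (fun (x : ι × κ) p => p x.1 x.2), hπ]
    constructor
    · intro h p hp
      by_contra hg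
      obtain ⟨p, h1, h2⟩ := (h.and (hφ g p hp hg)).exists
      exact h2.2 h1
    · exact fun h => hφB.mono fun p hp => h p (hBX p hp)
  rcases Ultrafilter.eventually_or.1 (hφB.mono hbad) with h | h
  · simp only [Ultrafilter.eventually_exists_iff] at h
    obtain ⟨i, j, h⟩ := h
    obtain ⟨hij, -⟩ := h.exists.choose_spec
    have h' : ∀ᶠ p : ι → κ → ℂ in φ, ∃ c : ℂ, p i = c • p j := h.mono fun _ h => h.2
    obtain ⟨c, hc⟩ := Filter.Eventually.choice h'
    refine hξ.notMem_span ⟨x₀, hx₀⟩ hnd (i := i) (v := fun _ : Unit => ξ j)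
      (fun _ => mem_othersField ξ hij.symm) ?_ ?_
    · have := hcard ∅ fun f hf => ?_
      · have := Fintype.one_lt_card_iff.2 ⟨i, j, hij⟩
        simp only [Fintype.card_unit]
        omega
      · rw [MvPolynomial.eq_C_of_isEmpty f] at hf ⊢
        simpa using hf x₀ hx₀
    · rw [Set.range_const, Submodule.mem_span_singleton]
      refine ⟨π c, funext fun l => ?_⟩
      rw [Pi.smul_apply, smul_eq_mul, ← map_mul, ← sub_eq_zero, ← map_sub, hπ]
      exact hc.mono fun p hp => by simp [hp]
  · simp only [Ultrafilter.eventually_exists_iff] at h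
    obtain ⟨i, j, h⟩ := h
    obtain ⟨hij, -⟩ := h.exists.choose_spec
    obtain ⟨a, ha⟩ := Filter.Eventually.choice (h.mono fun _ h => h.2)
    have hq : ∀ t, (∑ l, π (fun p => a p l) • ξ l) t = π fun p => (∑ l, a p l • p l) t := by
      intro t
      simp only [Finset.sum_apply, Pi.smul_apply, smul_eq_mul, ξ, ← map_mul, ← map_sum]
      congr 1
      ext p
      simp
    refine hξ.false_of_mem_secant hX ⟨x₀, hx₀⟩ hcone hnd hcard (a := fun l => π fun p => a p l)
      hij ?_ ?_ ?_ ?_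
    · intro h0
      obtain ⟨p, h1, h2⟩ := (((hπ _).1 h0).and ha).exists
      exact h2.1 h1
    · intro h0
      obtain ⟨p, h1, h2⟩ := (((hπ _).1 h0).and ha).exists
      exact h2.2.1 h1
    · intro h0
      have h1 : ∀ t, ∀ᶠ p in φ, (∑ l, a p l • p l) t = 0 := fun t => by
        rw [← hπ, ← hq, h0, Pi.zero_apply]
      obtain ⟨p, h1, h2⟩ := ((Filter.eventually_all.2 h1).and ha).exists
      exact h2.2.2.1 (funext h1)
    · intro f hf
      rw [funext hq, MvPolynomial.aeval_algHom_pi π (fun t p => (∑ l, a p l • p l) t), hπ]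
      exact ha.mono fun p hp => hf _ hp.2.2.2

theorem AlgebraicIndependent.exists_ltSeries {k B : Type u} [Field k] [CommRing B] [IsDomain B]
    [Algebra k B] [Algebra.FiniteType k B] {ι : Type*} [Finite ι] {x : ι → B}
    (hx : AlgebraicIndependent k x) :
    ∃ l : LTSeries (PrimeSpectrum B), Nat.card ι ≤ l.length := by
  obtain ⟨s, g, hinj, hint⟩ := exists_integral_inj_algHom_of_fg k B
  algebraize [g.toRingHom]
  have hT : IsScalarTower k (MvPolynomial (Fin s) k) B :=
    IsScalarTower.of_algebraMap_eq fun c => (g.commutes c).symm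
  have hf : FaithfulSMul (MvPolynomial (Fin s) k) B :=
    (faithfulSMul_iff_algebraMap_injective _ _).2 hinj
  have htr : Algebra.trdeg k B = s := by
    rw [← trdeg_add_eq k (MvPolynomial (Fin s) k) (A := B),
      trdeg_eq_zero (R := MvPolynomial (Fin s) k),
      MvPolynomial.trdeg_of_isDomain]
    simp
  have hs : Nat.card ι ≤ s := by
    have := hx.lift_cardinalMk_le_trdeg
    rw [htr, ← Nat.cast_card] at this
    simpa using this
  obtain ⟨l, hl⟩ : ∃ l : LTSeries (PrimeSpectrum (MvPolynomial (Fin s) k)), l.length = s := by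
    rw [← Order.le_krullDim_iff]
    change _ ≤ ringKrullDim _
    simp
  obtain ⟨P, hP, hPl⟩ := Ideal.exists_ideal_over_prime_of_isIntegral l.head.asIdeal (⊥ : Ideal B)
    (by rw [Ideal.comap_bot_of_injective (algebraMap _ _) hinj]; exact bot_le)
  have : P.LiesOver l.head.asIdeal := ⟨hPl.2.symm⟩
  have := hPl.1
  obtain ⟨l', hl', -⟩ := Ideal.exists_ltSeries_of_hasGoingUp l P
  exact ⟨l', by omega⟩

open MvPolynomial in
theorem eval_mem_polyFun {W σ : Type*} [AddCommGroup W] [Module ℂ W] (φ : σ → W →ₗ[ℂ] ℂ)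
    (g : MvPolynomial σ ℂ) : (fun w => eval (fun s => φ s w) g) ∈ PolyFun W := by
  induction g using MvPolynomial.induction_on with
  | C a =>
    simp only [eval_C]
    exact (PolyFun W).algebraMap_mem a
  | add f g hf hg =>
    simp only [map_add]
    exact add_mem hf hg
  | mul_X f s hf =>
    simp only [map_mul, eval_X]
    exact mul_mem hf (Algebra.subset_adjoin (R := ℂ) (φ s).isLinear)

open MvPolynomial in
theorem exists_eval_of_mem_polyFun {κ : Type*} [Fintype κ] {f : (κ → ℂ) → ℂ}
    (hf : f ∈ PolyFun (κ → ℂ)) : ∃ g : MvPolynomial κ ℂ, ∀ x, f x = aeval x g := by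
  classical
  induction hf using Algebra.adjoin_induction with
  | mem f hf =>
    have hf : IsLinearMap ℂ f := hf
    refine ⟨∑ j, C (f (Pi.single j 1)) * X j, fun x => ?_⟩
    conv_lhs => rw [pi_eq_sum_univ' x]
    change hf.mk' f _ = _
    simp [map_sum, mul_comm]
  | algebraMap c => exact ⟨C c, fun x => by simp⟩
  | add f g _ _ hf hg =>
    obtain ⟨f', hf⟩ := hf
    obtain ⟨g', hg⟩ := hg
    exact ⟨f' + g', fun x => by simp [hf, hg]⟩
  | mul f g _ _ hf hg =>
    obtain ⟨f', hf⟩ := hf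
    obtain ⟨g', hg⟩ := hg
    exact ⟨f' * g', fun x => by simp [hf, hg]⟩

theorem aeval_mem_polyFun {κ : Type*} (g : MvPolynomial κ ℂ) :
    (fun x => MvPolynomial.aeval x g) ∈ PolyFun (κ → ℂ) :=
  eval_mem_polyFun (fun j => LinearMap.proj j) g

theorem isAlgSet_zeroLocus {κ : Type*} (I : Ideal (MvPolynomial κ ℂ)) :
    IsAlgSet (MvPolynomial.zeroLocus ℂ I) :=
  ⟨{f | ∃ g ∈ I, f = fun x => MvPolynomial.aeval x g}, by
    rintro _ ⟨g, -, rfl⟩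
    exact aeval_mem_polyFun g, by
    ext x
    simp only [MvPolynomial.mem_zeroLocus_iff, Set.mem_ofPred_eq]
    exact ⟨by rintro h _ ⟨g, hg, rfl⟩; exact h g hg, fun h g hg => h _ ⟨g, hg, rfl⟩⟩⟩

theorem IsAlgSet.exists_aeval_ne_zero {κ : Type*} [Fintype κ] {X : Set (κ → ℂ)} (hX : IsAlgSet X)
    {x : κ → ℂ} (hx : x ∉ X) :
    ∃ g : MvPolynomial κ ℂ, (∀ y ∈ X, MvPolynomial.aeval y g = 0) ∧
      MvPolynomial.aeval x g ≠ 0 := by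
  obtain ⟨S, hS, rfl⟩ := hX
  simp only [Set.mem_ofPred_eq, not_forall] at hx
  obtain ⟨f, hf, hfx⟩ := hx
  obtain ⟨g, hg⟩ := exists_eval_of_mem_polyFun (hS hf)
  exact ⟨g, fun y hy => by rw [← hg]; exact hy f hf, by rwa [← hg]⟩

theorem IsAlgSet.zeroLocus_vanishingIdeal {κ : Type*} [Fintype κ] {X : Set (κ → ℂ)}
    (hX : IsAlgSet X) : MvPolynomial.zeroLocus ℂ (MvPolynomial.vanishingIdeal ℂ X) = X := by
  refine subset_antisymm (fun x hx => ?_) (MvPolynomial.zeroLocus_vanishingIdeal_le X)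
  by_contra h
  obtain ⟨g, hg, hgx⟩ := hX.exists_aeval_ne_zero h
  exact hgx (hx g hg)

theorem IsIrrAlg.isPrime_vanishingIdeal {κ : Type*} {X : Set (κ → ℂ)} (hX : IsIrrAlg X) :
    (MvPolynomial.vanishingIdeal ℂ X).IsPrime := by
  obtain ⟨⟨x, hx⟩, -, hirr⟩ := hX
  refine ⟨fun h => ?_, fun {f g} hfg => ?_⟩
  · simpa using ((Ideal.eq_top_iff_one _).1 h) x hx
  · refine (hirr _ _ (isAlgSet_zeroLocus (Ideal.span {f})) (isAlgSet_zeroLocus (Ideal.span {g}))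
      fun x hx => ?_).imp ?_ ?_
    · simpa [MvPolynomial.zeroLocus_span] using hfg x hx
    all_goals
      intro h x hx
      simpa [MvPolynomial.zeroLocus_span] using h hx

theorem isIrrAlg_zeroLocus {κ : Type*} [Fintype κ] (P : Ideal (MvPolynomial κ ℂ)) [hP : P.IsPrime] :
    IsIrrAlg (MvPolynomial.zeroLocus ℂ P) := by
  refine ⟨Set.nonempty_iff_ne_empty.2 fun h => hP.ne_top ?_, isAlgSet_zeroLocus P,
    fun Y Z hY hZ hYZ => ?_⟩
  · rw [← MvPolynomial.IsPrime.vanishingIdeal_zeroLocus (K := ℂ) P, h,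
      MvPolynomial.vanishingIdeal_empty]
  · by_contra! h
    obtain ⟨⟨x, hx, hxY⟩, y, hy, hyZ⟩ := And.imp Set.not_subset.1 Set.not_subset.1 h
    obtain ⟨f, hf, hfx⟩ := hY.exists_aeval_ne_zero hxY
    obtain ⟨g, hg, hgy⟩ := hZ.exists_aeval_ne_zero hyZ
    have hfg : f * g ∈ P := by
      rw [← MvPolynomial.IsPrime.vanishingIdeal_zeroLocus (K := ℂ) P]
      intro z hz
      rw [map_mul]
      exact (hYZ hz).elim (fun h => by rw [hf z h, zero_mul]) fun h => by rw [hg z h, mul_zero]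
    exact (hP.mem_or_mem hfg).elim (fun h => hfx (hx f h)) fun h => hgy (hy g h)

theorem ncard_le_adim {κ : Type} [Fintype κ] {X : Set (κ → ℂ)} (hX : IsIrrAlg X) {J : Set κ}
    (hJ : CoordIndepOn X J) : (J.ncard : ℕ∞) ≤ adim X := by
  let I := MvPolynomial.vanishingIdeal ℂ X
  have hI : I.IsPrime := hX.isPrime_vanishingIdeal
  have hind : AlgebraicIndependent ℂ fun j : J => Ideal.Quotient.mkₐ ℂ I (MvPolynomial.X j) := by
    rw [algebraicIndependent_iff]
    intro f hf
    refine hJ f fun x hx => ?_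
    have h : (MvPolynomial.aeval fun j : J => Ideal.Quotient.mkₐ ℂ I (MvPolynomial.X j)) =
        (Ideal.Quotient.mkₐ ℂ I).comp (MvPolynomial.rename Subtype.val) :=
      MvPolynomial.algHom_ext fun j => by simp
    rw [h, AlgHom.comp_apply, Ideal.Quotient.mkₐ_eq_mk, Ideal.Quotient.eq_zero_iff_mem] at hf
    have := hf x hx
    rwa [MvPolynomial.aeval_rename] at this
  obtain ⟨l, hl⟩ := hind.exists_ltSeries
  rw [Nat.card_coe_set_eq] at hl
  refine (Nat.cast_le.2 hl).trans (le_sSup ⟨l.length, rfl,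
    fun i => MvPolynomial.zeroLocus ℂ ((l i.rev).asIdeal.comap (Ideal.Quotient.mk I)),
    fun i j hij => ?_, fun i => ⟨isIrrAlg_zeroLocus _, ?_⟩⟩)
  · have hlt : (l j.rev).asIdeal.comap (Ideal.Quotient.mk I) <
        (l i.rev).asIdeal.comap (Ideal.Quotient.mk I) :=
      (Ideal.orderEmbeddingOfSurjective _ Ideal.Quotient.mk_surjective).strictMono
        (l.strictMono (Fin.rev_lt_rev.2 hij))
    refine lt_of_le_of_ne (MvPolynomial.zeroLocus_anti_mono hlt.le) fun h => hlt.ne ?_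
    have := congrArg (MvPolynomial.vanishingIdeal ℂ) h
    simpa using this.symm
  · conv_rhs => rw [← hX.2.1.zeroLocus_vanishingIdeal]
    refine MvPolynomial.zeroLocus_anti_mono fun f hf => ?_
    rw [Ideal.mem_comap, Ideal.Quotient.eq_zero_iff_mem.2 hf]
    exact zero_mem _

theorem subset_zcl {W : Type*} [AddCommGroup W] [Module ℂ W] (A : Set W) : A ⊆ zcl A :=
  Set.subset_sInter fun _ h => h.2

theorem isAlgSet_zcl {W : Type*} [AddCommGroup W] [Module ℂ W] (A : Set W) : IsAlgSet (zcl A) := by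
  refine ⟨{f | f ∈ PolyFun W ∧ ∀ x ∈ A, f x = 0}, fun f hf => hf.1, ?_⟩
  ext x
  refine ⟨fun hx f hf => hx {x | f x = 0} ⟨⟨{f}, by simpa using hf.1, by simp⟩, hf.2⟩, ?_⟩
  rintro hx _ ⟨⟨S, hS, rfl⟩, hA⟩
  exact fun f hf => hx f ⟨hS hf, fun y hy => hA hy f hf⟩

theorem exists_smul_or_exists_secant {ι W : Type*} [Fintype ι] [AddCommGroup W] [Module ℂ W]
    {X : Set W} (hX : ∀ (c : ℂ) (x : W), x ∈ X → c • x ∈ X) {p : ι → W} (hp : ∀ i, p i ∈ X)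
    (hbad : ¬ ((∀ i j, i ≠ j → (ℂ ∙ p i) ≠ (ℂ ∙ p j)) ∧
      X ∩ (Submodule.span ℂ (Set.range p) : Set W) =
        ⋃ i, ((ℂ ∙ p i : Submodule ℂ W) : Set W))) [Nonempty ι] :
    (∃ i j, i ≠ j ∧ ∃ c : ℂ, p i = c • p j) ∨
      ∃ i j, i ≠ j ∧ ∃ a : ι → ℂ, a i ≠ 0 ∧ a j ≠ 0 ∧ ∑ l, a l • p l ≠ 0 ∧
        ∑ l, a l • p l ∈ X := by
  classical
  by_contra! h
  refine hbad ⟨fun i j hij hs => ?_, subset_antisymm ?_ ?_⟩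
  · obtain ⟨c, hc⟩ := mem_span_singleton.1 (hs ▸ mem_span_singleton_self (p i))
    exact h.1 i j hij c hc.symm
  · rintro q ⟨hqX, hq⟩
    obtain ⟨a, rfl⟩ := (mem_span_range_iff_exists_fun ℂ).1 hq
    simp only [Set.mem_iUnion, SetLike.mem_coe]
    by_cases h0 : ∑ l, a l • p l = 0
    · rw [h0]
      exact ⟨Classical.arbitrary ι, zero_mem _⟩
    by_cases ha : ∃ i, a i ≠ 0
    · obtain ⟨i, hi⟩ := ha
      refine ⟨i, ?_⟩
      rw [Finset.sum_eq_single_of_mem i (Finset.mem_univ i) fun j _ hj => ?_]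
      · exact smul_mem _ _ (mem_span_singleton_self _)
      · by_contra hj0
        exact h.2 i j hj.symm a hi (fun h => hj0 (by rw [h, zero_smul])) h0 hqX
    · push Not at ha
      simp [ha] at h0
  · refine Set.iUnion_subset fun i q hq => ?_
    obtain ⟨c, rfl⟩ := mem_span_singleton.1 hq
    exact ⟨hX c _ (hp i), smul_mem _ _ (subset_span ⟨i, rfl⟩)⟩

theorem Nondeg.eq_zero {κ : Type*} [Fintype κ] {X : Set (κ → ℂ)} (hX : Nondeg X) (c : κ → ℂ)
    (h : ∀ x ∈ X, ∑ j, c j * x j = 0) : c = 0 := by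
  classical
  have hle : span ℂ X ≤ LinearMap.ker (∑ j, c j • LinearMap.proj j : (κ → ℂ) →ₗ[ℂ] ℂ) :=
    span_le.2 fun x hx => by simpa using h x hx
  rw [show span ℂ X = ⊤ from hX, top_le_iff] at hle
  funext j
  have : Pi.single j 1 ∈ LinearMap.ker (∑ j, c j • LinearMap.proj j : (κ → ℂ) →ₗ[ℂ] ℂ) :=
    hle ▸ mem_top
  simpa [Pi.single_apply] using this

/-- If `k < r - n`, a general `(k+1)`-secant `k`-plane meets `X` in exactly `k+1`
points: for a general tuple spanning it, the points give distinct lines and the plane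
meets the cone `X` exactly in the union of these `k+1` lines. -/
theorem general_secant_plane_meets_in_k_plus_one_points (r n k : ℕ) (hk : k + n < r)
    (X : Set (Fin (r + 1) → ℂ)) (hX : IsProjVar X) (hnd : Nondeg X)
    (hdim : pdim X = (n : ℕ∞)) :
    ∃ Z : Set (Fin (k + 1) → Fin (r + 1) → ℂ), IsAlgSet Z ∧
      ¬ ({p : Fin (k + 1) → Fin (r + 1) → ℂ | ∀ i, p i ∈ X} ⊆ Z) ∧
      ∀ p : Fin (k + 1) → Fin (r + 1) → ℂ, (∀ i, p i ∈ X) → p ∉ Z →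
        (∀ i j, i ≠ j → (ℂ ∙ p i) ≠ (ℂ ∙ p j)) ∧
        X ∩ (Submodule.span ℂ (Set.range p) : Set (Fin (r + 1) → ℂ)) =
          ⋃ i, ((ℂ ∙ p i : Submodule ℂ (Fin (r + 1) → ℂ)) : Set (Fin (r + 1) → ℂ)) := by
  obtain ⟨halg, ⟨h0, hcone⟩, hirr, -⟩ := hX
  let B : Set (Fin (k + 1) → Fin (r + 1) → ℂ) := {p | (∀ i, p i ∈ X) ∧
    ¬ ((∀ i j, i ≠ j → (ℂ ∙ p i) ≠ (ℂ ∙ p j)) ∧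
      X ∩ (Submodule.span ℂ (Set.range p) : Set (Fin (r + 1) → ℂ)) =
        ⋃ i, ((ℂ ∙ p i : Submodule ℂ (Fin (r + 1) → ℂ)) : Set (Fin (r + 1) → ℂ)))}
  refine ⟨zcl B, isAlgSet_zcl B, fun hsub => ?_, fun p hp hpZ => ?_⟩
  · refine false_of_dense_bad_tuples hirr.isPrime_vanishingIdeal ⟨0, h0⟩ hcone hnd.eq_zero
      (fun J hJ => ?_) (B := B) (fun p hp => hp.1) (fun g hg p hp => ?_)
      fun p hp => exists_smul_or_exists_secant hcone hp.1 hp.2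
    · have h1 : adim X ≤ (n : ℕ∞) + 1 := tsub_le_iff_right.1 hdim.le
      have h2 : J.ncard ≤ n + 1 := by exact_mod_cast (ncard_le_adim hirr hJ).trans h1
      simp only [Fintype.card_fin]
      omega
    · have hmem := eval_mem_polyFun (W := Fin (k + 1) → Fin (r + 1) → ℂ)
        (fun x : Fin (k + 1) × Fin (r + 1) => LinearMap.proj x.2 ∘ₗ LinearMap.proj x.1) g
      exact hsub hp _ ⟨⟨{_}, Set.singleton_subset_iff.2 hmem, rfl⟩,
        fun q hq f hf => hf ▸ hg q hq⟩ _ rfl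
  · by_contra h
    exact hpZ (subset_zcl B ⟨hp, h⟩)
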